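/- Correctness of the TGM upper bound (Equation (2)) for Jaccard similarity: for every nonempty finite query set Q and every group 𝒢, and for every S ∈ 𝒢, J(Q, S) ≤ |Q ∩ GS(𝒢)| / |Q|. -/

import Mathlib

/-- Jaccard similarity of two finite sets of tokens, with the convention
`J(Q,S) = 0` when `Q ∪ S` is empty. -/
noncomputable def jaccard {α : Type*} [DecidableEq α] (Q S : Finset α) : ℝ :=
  ((Q ∩ S).card : ℝ) / ((Q ∪ S).card : ℝ)

/-- Correctness of the TGM upper bound (Equation (2)) for Jaccard similarity:
for every nonempty query set `Q`, group `G` (with `GS(G) = G.sup id`),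
and every `S ∈ G`, `J(Q,S) ≤ |Q ∩ GS(G)| / |Q|`. -/
theorem tgm_upper_bound_jaccard {α : Type*} [DecidableEq α]
    (Q : Finset α) (hQ : Q.Nonempty) (G : Finset (Finset α)) :
    ∀ S ∈ G, jaccard Q S ≤ ((Q ∩ G.sup id).card : ℝ) / (Q.card : ℝ) := by
  intro S hS
  have hsub : S ⊆ G.sup id := Finset.le_sup (f := id) hS
  have hpos : (0 : ℝ) < (Q.card : ℝ) := by exact_mod_cast hQ.card_pos
  have hnum : ((Q ∩ S).card : ℝ) ≤ ((Q ∩ G.sup id).card : ℝ) := by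
    exact_mod_cast Finset.card_le_card (Finset.inter_subset_inter_left hsub)
  have hden : (Q.card : ℝ) ≤ ((Q ∪ S).card : ℝ) := by
    exact_mod_cast Finset.card_le_card Finset.subset_union_left
  unfold jaccard
  exact div_le_div₀ (Nat.cast_nonneg _) hnum hpos hden
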